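/- arXiv:2006.14093 — 2 statements merged into one kernel-verified Lean document; each statement's English description precedes it below -/
import Mathlib

section
/- There exist indices i*, j* with 1 ≤ i* ≤ j* ≤ n and a vertex index c* with c* ≤ i* or c* ≥ j* such that rad(i*,j*) = r* and ecc(i*,j*,c*) = rad(i*,j*); that is, some optimal augmenting edge admits a center that does not lie strictly between the endpoints of the added edge. -/
/-- Path distance along `P` between vertices `a` and `b`. -/
noncomputable def dP {X : Type*} [MetricSpace X] (v : ℕ → X) (a b : ℕ) : ℝ :=
  ∑ m ∈ Finset.Ico (min a b) (max a b), dist (v m) (v (m + 1))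

/-- Shortest-path distance in the augmented graph `G(i,j)`. -/
noncomputable def dG {X : Type*} [MetricSpace X] (v : ℕ → X) (i j a b : ℕ) : ℝ :=
  min (dP v a b)
    (min (dP v a i + dist (v i) (v j) + dP v j b)
         (dP v a j + dist (v i) (v j) + dP v i b))

/-- Eccentricity of vertex `c` in `G(i,j)`: `max_{1 ≤ k ≤ n} dG(c,k)`. -/
noncomputable def ecc {X : Type*} [MetricSpace X] (v : ℕ → X) (n i j c : ℕ) : ℝ :=
  sSup ((fun k => dG v i j c k) '' Set.Icc 1 n)

/-- Radius of `G(i,j)`: `min_{1 ≤ c ≤ n} ecc(i,j,c)`. -/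
noncomputable def rad {X : Type*} [MetricSpace X] (v : ℕ → X) (n i j : ℕ) : ℝ :=
  sInf ((fun c => ecc v n i j c) '' Set.Icc 1 n)

/-- Optimal radius: `min_{1 ≤ i ≤ j ≤ n} rad(i,j)`. -/
noncomputable def rstar {X : Type*} [MetricSpace X] (v : ℕ → X) (n : ℕ) : ℝ :=
  sInf {x | ∃ i j : ℕ, 1 ≤ i ∧ i ≤ j ∧ j ≤ n ∧ x = rad v n i j}

noncomputable def pos {X : Type*} [MetricSpace X] (v : ℕ → X) (k : ℕ) : ℝ :=
  ∑ m ∈ Finset.range k, dist (v m) (v (m + 1))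

theorem pos_mono {X : Type*} [MetricSpace X] (v : ℕ → X) : Monotone (pos v) := by
  refine monotone_nat_of_le_succ fun k => ?_
  unfold pos
  rw [Finset.sum_range_succ]
  have := dist_nonneg (x := v k) (y := v (k + 1))
  linarith

theorem dP_le {X : Type*} [MetricSpace X] (v : ℕ → X) {a b : ℕ} (h : a ≤ b) :
    dP v a b = pos v b - pos v a := by
  unfold dP pos
  rw [min_eq_left h, max_eq_right h, Finset.sum_Ico_eq_sub _ h]

theorem dP_ge {X : Type*} [MetricSpace X] (v : ℕ → X) {a b : ℕ} (h : b ≤ a) :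
    dP v a b = pos v a - pos v b := by
  unfold dP pos
  rw [min_eq_right h, max_eq_left h, Finset.sum_Ico_eq_sub _ h]

theorem dist_le_pos {X : Type*} [MetricSpace X] (v : ℕ → X) {a b : ℕ} (h : a ≤ b) :
    dist (v a) (v b) ≤ pos v b - pos v a := by
  rw [← dP_le v h]
  unfold dP
  rw [min_eq_left h, max_eq_right h]
  exact dist_le_Ico_sum_dist v h

theorem dP_nonneg {X : Type*} [MetricSpace X] (v : ℕ → X) (a b : ℕ) : 0 ≤ dP v a b :=
  Finset.sum_nonneg fun _ _ => dist_nonneg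

theorem dG_le_ecc {X : Type*} [MetricSpace X] (v : ℕ → X) (n i j c k : ℕ)
    (h1 : 1 ≤ k) (h2 : k ≤ n) : dG v i j c k ≤ ecc v n i j c :=
  le_csSup ((Set.finite_Icc 1 n).image _).bddAbove ⟨k, ⟨h1, h2⟩, rfl⟩

theorem ecc_le {X : Type*} [MetricSpace X] (v : ℕ → X) (n i j c : ℕ) (hn : 1 ≤ n) (r : ℝ)
    (h : ∀ k, 1 ≤ k → k ≤ n → dG v i j c k ≤ r) : ecc v n i j c ≤ r := by
  refine csSup_le ⟨_, 1, ⟨le_rfl, hn⟩, rfl⟩ ?_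
  rintro _ ⟨k, hk, rfl⟩
  exact h k hk.1 hk.2

theorem rad_le {X : Type*} [MetricSpace X] (v : ℕ → X) (n i j c : ℕ)
    (h1 : 1 ≤ c) (h2 : c ≤ n) : rad v n i j ≤ ecc v n i j c :=
  csInf_le ((Set.finite_Icc 1 n).image _).bddBelow ⟨c, ⟨h1, h2⟩, rfl⟩

theorem rset_finite {X : Type*} [MetricSpace X] (v : ℕ → X) (n : ℕ) :
    {x | ∃ i j : ℕ, 1 ≤ i ∧ i ≤ j ∧ j ≤ n ∧ x = rad v n i j}.Finite := by
  refine (((Set.finite_Icc 1 n).prod (Set.finite_Icc 1 n)).image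
    (fun p : ℕ × ℕ => rad v n p.1 p.2)).subset ?_
  rintro x ⟨i, j, h1, h2, h3, rfl⟩
  exact ⟨(i, j), ⟨⟨h1, h2.trans h3⟩, ⟨h1.trans h2, h3⟩⟩, rfl⟩

theorem key {X : Type*} [MetricSpace X] (v : ℕ → X) (n i j c : ℕ)
    (h1 : 1 ≤ i) (hic : i < c) (hcj : c < j) (hjn : j ≤ n) :
    ecc v n c j c ≤ ecc v n i j c ∨ ecc v n i c c ≤ ecc v n i j c := by
  have hd := dist_nonneg (x := v i) (y := v j)
  have mic := pos_mono v hic.le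
  have mcj := pos_mono v hcj.le
  have m1i := pos_mono v h1
  have mjn := pos_mono v hjn
  have dic := dist_le_pos v hic.le
  have dcj := dist_le_pos v hcj.le
  by_cases hA : pos v c - pos v 1 ≤ ecc v n i j c
  · left
    refine ecc_le v n c j c (by omega) _ fun k hk1 hkn => ?_
    have m1k := pos_mono v hk1
    rcases le_total k c with hkc | hck
    · refine (min_le_left _ _).trans ?_
      rw [dP_ge v hkc]; linarith
    · refine le_trans ?_ (dG_le_ecc v n i j c k hk1 hkn)
      have mck := pos_mono v hck
      have ht := dist_triangle (v c) (v i) (v j)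
      rw [dist_comm (v c) (v i)] at ht
      unfold dG
      refine le_min (min_le_left _ _) (le_min ?_ ?_)
      · refine (min_le_right _ _).trans ((min_le_left _ _).trans ?_)
        rw [dP_le v (le_refl c), dP_ge v hic.le]; linarith
      · refine (min_le_left _ _).trans ?_
        rw [dP_le v hck, dP_le v hcj.le, dP_le v (hic.le.trans hck)]; linarith
  by_cases hB : pos v n - pos v c ≤ ecc v n i j c
  · right
    refine ecc_le v n i c c (by omega) _ fun k hk1 hkn => ?_
    have mkn := pos_mono v hkn
    rcases le_total c k with hck | hkc
    · refine (min_le_left _ _).trans ?_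
      rw [dP_le v hck]; linarith
    · refine le_trans ?_ (dG_le_ecc v n i j c k hk1 hkn)
      have mck := pos_mono v hkc
      have ht := dist_triangle (v i) (v j) (v c)
      rw [dist_comm (v j) (v c)] at ht
      unfold dG
      refine le_min (min_le_left _ _) (le_min ?_ ?_)
      · refine (min_le_left _ _).trans ?_
        rw [dP_ge v hkc, dP_ge v hic.le, dP_ge v (hkc.trans hcj.le)]; linarith
      · refine (min_le_right _ _).trans ((min_le_right _ _).trans ?_)
        rw [dP_le v (le_refl c), dP_le v hcj.le]; linarith
  exfalso
  push Not at hA hB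
  have e1 := dG_le_ecc v n i j c 1 le_rfl (by omega)
  have e2 := dG_le_ecc v n i j c n (by omega) le_rfl
  unfold dG at e1 e2
  rw [dP_ge v (show 1 ≤ c by omega), dP_ge v hic.le, dP_le v hcj.le, dP_ge v h1,
    dP_ge v (show 1 ≤ j by omega), min_le_iff, min_le_iff] at e1
  rw [dP_le v (show c ≤ n by omega), dP_ge v hic.le, dP_le v hcj.le, dP_le v hjn,
    dP_le v (show i ≤ n by omega), min_le_iff, min_le_iff] at e2
  rcases e1 with e1 | e1 | e1 <;> rcases e2 with e2 | e2 | e2 <;> linarith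

/-- Some optimal augmenting edge admits a center not strictly
between the endpoints of the added edge. -/
theorem stmt_1 {X : Type*} [MetricSpace X] (n : ℕ) (hn : 2 ≤ n) (v : ℕ → X)
    (hv : Set.InjOn v (Set.Icc 1 n)) :
    ∃ istar jstar cstar : ℕ,
      1 ≤ istar ∧ istar ≤ jstar ∧ jstar ≤ n ∧
      1 ≤ cstar ∧ cstar ≤ n ∧
      (cstar ≤ istar ∨ jstar ≤ cstar) ∧
      rad v n istar jstar = rstar v n ∧
      ecc v n istar jstar cstar = rad v n istar jstar := by
  obtain ⟨i, j, h1, hij, hjn, hr⟩ : rstar v n ∈ _ :=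
    Set.Nonempty.csInf_mem ⟨_, 1, 1, le_rfl, le_rfl, by omega, rfl⟩ (rset_finite v n)
  obtain ⟨c, ⟨hc1, hcn⟩, hc⟩ : rad v n i j ∈ _ :=
    Set.Nonempty.csInf_mem ((Set.nonempty_Icc.2 (by omega : 1 ≤ n)).image _)
      ((Set.finite_Icc 1 n).image _)
  simp only at hc
  have fin : ∀ i' j', 1 ≤ i' → i' ≤ j' → j' ≤ n → ecc v n i' j' c ≤ ecc v n i j c →
      rad v n i' j' = rstar v n ∧ ecc v n i' j' c = rad v n i' j' := by
    intro i' j' a1 a2 a3 a4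
    have b1 := rad_le v n i' j' c hc1 hcn
    have b2 : rstar v n ≤ rad v n i' j' :=
      csInf_le (rset_finite v n).bddBelow ⟨i', j', a1, a2, a3, rfl⟩
    constructor <;> linarith
  by_cases hout : c ≤ i ∨ j ≤ c
  · exact ⟨i, j, c, h1, hij, hjn, hc1, hcn, hout, fin i j h1 hij hjn le_rfl⟩
  push Not at hout
  rcases key v n i j c h1 hout.1 hout.2 hjn with h | h
  · exact ⟨c, j, c, hc1, hout.2.le, hjn, hc1, hcn, Or.inl le_rfl,
      fin c j hc1 hout.2.le hjn h⟩
  · exact ⟨i, c, c, h1, hout.1.le, hcn, hc1, hcn, Or.inr le_rfl,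
      fin i c h1 hout.1.le hcn h⟩
end

section
/- Suppose 1 ≤ i* < j* ≤ n, rad(i*,j*) = r*, and there is a center c* of G(i*,j*) with c* ≤ i* (i.e., ecc(i*,j*,c*) = r*). Then min_{1 ≤ i ≤ n−1} r_i = r*. -/
/-- `λ_i = min_{i ≤ j ≤ n} max_{i ≤ k ≤ n} dG(i,j)(i,k)`. -/
noncomputable def lam {X : Type*} [MetricSpace X] (v : ℕ → X) (n i : ℕ) : ℝ :=
  sInf ((fun j => sSup ((fun k => dG v i j i k) '' Set.Icc i n)) '' Set.Icc i n)

/-- `r_i = min_{1 ≤ c ≤ i} max( dP(1,c), dP(c,i) + λ_i )`. -/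
noncomputable def rI {X : Type*} [MetricSpace X] (v : ℕ → X) (n i : ℕ) : ℝ :=
  sInf ((fun c => max (dP v 1 c) (dP v c i + lam v n i)) '' Set.Icc 1 i)

theorem dP_exists {X : Type*} [MetricSpace X] (v : ℕ → X) :
    ∃ F : ℕ → ℝ, Monotone F ∧ ∀ a b, dP v a b = |F b - F a| := by
  have hm : Monotone (fun a => ∑ m ∈ Finset.range a, dist (v m) (v (m + 1))) := by
    refine monotone_nat_of_le_succ fun a => ?_
    rw [Finset.sum_range_succ]
    linarith [dist_nonneg (x := v a) (y := v (a + 1))]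
  refine ⟨_, hm, fun a b => ?_⟩
  unfold dP
  rcases le_total a b with h | h
  · rw [min_eq_left h, max_eq_right h, Finset.sum_Ico_eq_sub _ h,
      abs_of_nonneg (sub_nonneg.2 (hm h))]
  · rw [min_eq_right h, max_eq_left h, Finset.sum_Ico_eq_sub _ h,
      abs_of_nonpos (sub_nonpos.2 (hm h))]
    ring

theorem dP_comm {X : Type*} [MetricSpace X] (v : ℕ → X) (a b : ℕ) : dP v a b = dP v b a := by
  unfold dP
  rw [min_comm, max_comm]

theorem dP_add {X : Type*} [MetricSpace X] (v : ℕ → X) {a b c : ℕ} (h : a ≤ b) (h' : b ≤ c) :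
    dP v a c = dP v a b + dP v b c := by
  obtain ⟨F, hF, e⟩ := dP_exists v
  rw [e, e, e, abs_of_nonneg (sub_nonneg.2 (hF h)), abs_of_nonneg (sub_nonneg.2 (hF h')),
    abs_of_nonneg (sub_nonneg.2 (hF (h.trans h')))]
  ring

theorem dG_nonneg {X : Type*} [MetricSpace X] (v : ℕ → X) (i j a b : ℕ) : 0 ≤ dG v i j a b := by
  have hp := dP_nonneg v
  have := dist_nonneg (x := v i) (y := v j)
  unfold dG
  refine le_min (hp _ _) (le_min ?_ ?_)
  · linarith [hp a i, hp j b]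
  · linarith [hp a j, hp i b]

theorem dG_split {X : Type*} [MetricSpace X] (v : ℕ → X) {i j c k : ℕ} (h : c ≤ i) (hj : i ≤ j)
    (hk : i ≤ k) : dG v i j c k = dP v c i + dG v i j i k := by
  unfold dG
  have h0 : dP v i i = 0 := by simp [dP]
  rw [dP_add v h hk, dP_add v h hj, h0, ← min_add_add_left, ← min_add_add_left]
  ring_nf

theorem dG_one {X : Type*} [MetricSpace X] (v : ℕ → X) {i j c : ℕ} (h1 : 1 ≤ c) (h : c ≤ i)
    (hj : i ≤ j) : dP v 1 c ≤ dG v i j c 1 := by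
  have hp := dP_nonneg v
  have := dist_nonneg (x := v i) (y := v j)
  unfold dG
  rw [dP_comm v c 1, dP_comm v j 1, dP_comm v i 1, dP_add v h1 h, dP_add v h1 (h.trans hj)]
  refine le_min le_rfl (le_min ?_ ?_)
  · linarith [hp c i, hp c j]
  · linarith [hp c i, hp c j]

theorem img_fin (f : ℕ → ℝ) (a b : ℕ) : (f '' Set.Icc a b).Finite := (Set.finite_Icc a b).image f

theorem rstar_le {X : Type*} [MetricSpace X] (v : ℕ → X) {n i j c : ℕ} (hi : 1 ≤ i) (hj : i ≤ j)
    (hn : j ≤ n) (hc : 1 ≤ c) (hcn : c ≤ n) : rstar v n ≤ ecc v n i j c := by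
  have h1 : rad v n i j ≤ ecc v n i j c :=
    csInf_le (img_fin _ _ _).bddBelow ⟨c, ⟨hc, hcn⟩, rfl⟩
  refine le_trans (csInf_le ?_ ⟨i, j, hi, hj, hn, rfl⟩) h1
  refine ⟨0, ?_⟩
  rintro x ⟨i, j, -, -, -, rfl⟩
  refine Real.sInf_nonneg ?_
  rintro x ⟨c, -, rfl⟩
  refine Real.sSup_nonneg ?_
  rintro x ⟨k, -, rfl⟩
  exact dG_nonneg _ _ _ _ _

/-- if an optimal `G(i*,j*)` has a center `c* ≤ i*`, then
`min_{1 ≤ i ≤ n−1} r_i = r*`. -/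
theorem stmt_4 {X : Type*} [MetricSpace X] (n : ℕ) (hn : 2 ≤ n) (v : ℕ → X)
    (hv : Set.InjOn v (Set.Icc 1 n))
    (istar jstar cstar : ℕ)
    (hi : 1 ≤ istar) (hij : istar < jstar) (hjn : jstar ≤ n)
    (hopt : rad v n istar jstar = rstar v n)
    (hc1 : 1 ≤ cstar) (hci : cstar ≤ istar)
    (hcenter : ecc v n istar jstar cstar = rstar v n) :
    sInf ((fun i => rI v n i) '' Set.Icc 1 (n - 1)) = rstar v n := by
  have hin : istar ≤ n - 1 := by omega
  apply le_antisymm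
  · refine le_trans (csInf_le (img_fin _ _ _).bddBelow ⟨istar, ⟨hi, hin⟩, rfl⟩) ?_
    refine le_trans (csInf_le (img_fin _ _ _).bddBelow ⟨cstar, ⟨hc1, hci⟩, rfl⟩) ?_
    have hE : ∀ k, 1 ≤ k → k ≤ n → dG v istar jstar cstar k ≤ rstar v n := by
      intro k h1 h2
      rw [← hcenter]
      exact le_csSup (img_fin _ _ _).bddAbove ⟨k, ⟨h1, h2⟩, rfl⟩
    refine max_le ((dG_one v hc1 hci hij.le).trans (hE 1 le_rfl (by omega))) ?_
    have hl : lam v n istar ≤ rstar v n - dP v cstar istar := by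
      refine le_trans (csInf_le (img_fin _ _ _).bddBelow ⟨jstar, ⟨hij.le, hjn⟩, rfl⟩) ?_
      refine csSup_le ⟨_, istar, ⟨le_rfl, by omega⟩, rfl⟩ ?_
      rintro x ⟨k, ⟨hk1, hk2⟩, rfl⟩
      have := hE k (by omega) hk2
      rw [dG_split v hci hij.le hk1] at this
      show dG v istar jstar istar k ≤ _
      linarith
    show dP v cstar istar + lam v n istar ≤ _
    linarith
  · refine le_csInf ⟨_, 1, ⟨le_rfl, by omega⟩, rfl⟩ ?_
    rintro x ⟨i, ⟨hi1, hi2⟩, rfl⟩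
    refine le_csInf ⟨_, 1, ⟨le_rfl, hi1⟩, rfl⟩ ?_
    rintro x ⟨c, ⟨hc1', hci'⟩, rfl⟩
    have hin' : i ≤ n := by omega
    have hmem : lam v n i ∈
        (fun j => sSup ((fun k => dG v i j i k) '' Set.Icc i n)) '' Set.Icc i n :=
      Set.Nonempty.csInf_mem ⟨_, i, ⟨le_rfl, hin'⟩, rfl⟩ (img_fin _ _ _)
    obtain ⟨j, ⟨hj1, hj2⟩, hj⟩ := hmem
    have hL : ∀ k, i ≤ k → k ≤ n → dG v i j i k ≤ lam v n i := by
      intro k h1 h2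
      rw [← hj]
      exact le_csSup (img_fin _ _ _).bddAbove ⟨k, ⟨h1, h2⟩, rfl⟩
    refine (rstar_le v hi1 hj1 hj2 hc1' (hci'.trans hin')).trans ?_
    refine csSup_le ⟨_, 1, ⟨le_rfl, by omega⟩, rfl⟩ ?_
    rintro x ⟨k, ⟨hk1, hk2⟩, rfl⟩
    have hle : dG v i j c k ≤ dP v c k := min_le_left _ _
    have hp := dP_nonneg v
    show dG v i j c k ≤ max (dP v 1 c) (dP v c i + lam v n i)
    rcases le_total k c with h | h
    · refine le_max_of_le_left (hle.trans ?_)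
      rw [dP_comm v c k, dP_add v hk1 h]
      linarith [hp 1 k]
    · refine le_max_of_le_right ?_
      rcases le_total k i with h' | h'
      · have := (dG_nonneg v i j i i).trans (hL i le_rfl hin')
        rw [dP_add v h h']
        linarith [hp k i]
      · rw [dG_split v hci' hj1 h']
        linarith [hL k h' hk2]
end
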